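/- arXiv:1108.1098 — 2 statements merged into one kernel-verified Lean document; each statement's English description precedes it below -/
import Mathlib

section
/- Let m ≥ 1, let p0 : ℝ → ℝ be a nonnegative measurable function, let P be an invertible m×m real matrix, set Σ = P * Pᵀ, and let μ ∈ ℝ^m. Then the pushforward under the map z ↦ P⁻¹.mulVec (z − μ) of the measure (volume on ℝ^m).withDensity (z ↦ (det Σ)^{-1/2} · p0 ((z − μ) ⬝ᵥ Σ⁻¹.mulVec (z − μ))) equals (volume).withDensity (z ↦ p0 (z ⬝ᵥ z)). In particular the distribution of the standardized vector P⁻¹(Z − μ) does not depend on μ or Σ. -/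
open Matrix MeasureTheory

/-- Pushing forward a density that factors through `T` gives the density on the pushforward. -/
theorem map_withDensity_comp {α β : Type*} [MeasurableSpace α] [MeasurableSpace β]
    (ν : Measure α) {T : α → β} (hT : Measurable T) {f : β → ENNReal} (hf : Measurable f) :
    Measure.map T (ν.withDensity fun a => f (T a)) = (Measure.map T ν).withDensity f := by
  ext s hs
  rw [Measure.map_apply hT hs, withDensity_apply _ (hT hs), withDensity_apply _ hs,
    setLIntegral_map hs hf hT]

/-- An affine standardization scales Lebesgue measure by the absolute determinant. -/
theorem map_inv_mulVec_sub_volume {ι : Type*} [Fintype ι] [DecidableEq ι] {P : Matrix ι ι ℝ}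
    (hP : IsUnit P.det) (μ : ι → ℝ) :
    Measure.map (fun z : ι → ℝ => P⁻¹ *ᵥ (z - μ)) volume =
      ENNReal.ofReal |P.det| • (volume : Measure (ι → ℝ)) := by
  have hdet : P⁻¹.det ≠ 0 := (P.isUnit_nonsing_inv_det hP).ne_zero
  have hlin := Real.map_matrix_volume_pi_eq_smul_volume_pi hdet
  rw [det_nonsing_inv, Ring.inverse_eq_inv', inv_inv] at hlin
  have hmeas : Measurable (toLin' P⁻¹) := (toLin' P⁻¹).continuous_of_finiteDimensional.measurable
  rw [← hlin, ← (measurePreserving_sub_right (volume : Measure (ι → ℝ)) μ).map_eq,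
    Measure.map_map hmeas (measurable_sub_const μ),
    (measurePreserving_sub_right (volume : Measure (ι → ℝ)) μ).map_eq]
  rfl

/-- The quadratic form of `(P Pᵀ)⁻¹` is the squared length after applying `P⁻¹`. -/
theorem dotProduct_inv_mul_transpose_mulVec {ι R : Type*} [Fintype ι] [DecidableEq ι]
    [CommRing R] (P : Matrix ι ι R) (w : ι → R) :
    w ⬝ᵥ (P * Pᵀ)⁻¹ *ᵥ w = (P⁻¹ *ᵥ w) ⬝ᵥ (P⁻¹ *ᵥ w) := by
  rw [Matrix.mul_inv_rev, ← transpose_nonsing_inv, ← mulVec_mulVec, dotProduct_mulVec,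
    vecMul_transpose]

theorem rpow_neg_half_det_mul_transpose {ι : Type*} [Fintype ι] [DecidableEq ι]
    (P : Matrix ι ι ℝ) : (P * Pᵀ).det ^ (-(1 : ℝ) / 2) = |P.det|⁻¹ := by
  rw [det_mul, det_transpose, neg_div, Real.rpow_neg (mul_self_nonneg _), ← Real.sqrt_eq_rpow,
    Real.sqrt_mul_self_eq_abs]

/-- If `Z` has the elliptical density `(det Σ)^{-1/2} p0((z − μ)ᵀ Σ⁻¹ (z − μ))` with
`Σ = P Pᵀ`, then the standardized vector `P⁻¹ (Z − μ)` has density `p0(zᵀz)`; in particular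
its distribution does not depend on `μ` or `Σ`. -/
theorem stmt_1 (m : ℕ) (hm : 1 ≤ m) (p0 : ℝ → ℝ) (hp0meas : Measurable p0)
    (hp0nonneg : ∀ y, 0 ≤ p0 y)
    (P : Matrix (Fin m) (Fin m) ℝ) (hP : IsUnit P.det)
    (S : Matrix (Fin m) (Fin m) ℝ) (hS : S = P * Pᵀ) (μ : Fin m → ℝ) :
    Measure.map (fun z : Fin m → ℝ => P⁻¹.mulVec (z - μ))
        ((volume : Measure (Fin m → ℝ)).withDensity fun z =>
          ENNReal.ofReal (S.det ^ (-(1 : ℝ) / 2) * p0 ((z - μ) ⬝ᵥ S⁻¹.mulVec (z - μ))))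
      = (volume : Measure (Fin m → ℝ)).withDensity fun z => ENNReal.ofReal (p0 (z ⬝ᵥ z)) := by
  subst hS
  have hf : Measurable fun z : Fin m → ℝ => ENNReal.ofReal (p0 (z ⬝ᵥ z)) :=
    (hp0meas.comp (by fun_prop : Continuous fun z : Fin m → ℝ => z ⬝ᵥ z).measurable).ennreal_ofReal
  have hT : Measurable fun z : Fin m → ℝ => P⁻¹ *ᵥ (z - μ) :=
    (by fun_prop : Continuous fun z : Fin m → ℝ => P⁻¹ *ᵥ (z - μ)).measurable
  have hpos : 0 < |P.det| := abs_pos.mpr hP.ne_zero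
  simp_rw [dotProduct_inv_mul_transpose_mulVec, rpow_neg_half_det_mul_transpose,
    ENNReal.ofReal_mul (inv_nonneg.mpr hpos.le)]
  rw [map_withDensity_comp volume hT (hf.const_mul (ENNReal.ofReal |P.det|⁻¹)),
    map_inv_mulVec_sub_volume hP, withDensity_smul_measure]
  change _ • volume.withDensity (ENNReal.ofReal |P.det|⁻¹ • _) = _
  rw [withDensity_smul _ hf, smul_smul, ← ENNReal.ofReal_mul hpos.le,
    mul_inv_cancel₀ hpos.ne', ENNReal.ofReal_one, one_smul]
end

section
/- Let n be a finite index type, N ≥ 1, z_1, …, z_N ∈ ℝ^n, let p0 : ℝ → ℝ be differentiable and strictly positive, and let Σ : ℝ → Matrix n n ℝ and μ : ℝ → ℝ^n be differentiable at t₀ with Σ(t₀) symmetric and positive definite. Write d_j(t) = z_j − μ(t), q_j(t) = d_j(t) ⬝ᵥ Σ(t)⁻¹.mulVec d_j(t), W(u) = p0'(u)/p0(u), and let Σ', μ' be the derivatives at t₀ and Σ^{(·)} = −Σ(t₀)⁻¹ * Σ' * Σ(t₀)⁻¹. Then the log-likelihood ℓ(t) = −(N/2)·log (det Σ(t)) +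 Σ_{j=1}^N log p0(q_j(t)) is differentiable at t₀ with derivative ℓ'(t₀) = −(N/2)·trace(Σ(t₀)⁻¹ * Σ') + Σ_{j=1}^N W(q_j(t₀)) · ( d_j(t₀) ⬝ᵥ Σ^{(·)}.mulVec d_j(t₀) − 2 · μ' ⬝ᵥ Σ(t₀)⁻¹.mulVec d_j(t₀) ). -/
open Matrix

attribute [local instance] Matrix.normedAddCommGroup Matrix.normedSpace

theorem HasDerivAt.matrix_det {n : Type*} [Fintype n] [DecidableEq n] {S : ℝ → Matrix n n ℝ}
    {S' : Matrix n n ℝ} {t : ℝ} (hS : HasDerivAt S S' t) :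
    HasDerivAt (fun s => (S s).det) ((S t).adjugate * S').trace t := by
  have hentry (i j : n) : HasDerivAt (fun s => S s i j) (S' i j) t :=
    hasDerivAt_pi.1 (hasDerivAt_pi.1 hS i) j
  have hsum : ((S t).adjugate * S').trace = ∑ i, ((S t).updateCol i fun k => S' k i).det := by
    simp only [← cramer_apply, cramer_eq_adjugate_mulVec]
    rfl
  rw [hsum]
  simp only [det_apply']
  rw [Finset.sum_comm]
  refine HasDerivAt.fun_sum fun σ _ => ?_
  rw [← Finset.mul_sum]
  refine HasDerivAt.const_mul _ ?_
  refine (HasDerivAt.fun_finsetProd fun i _ => hentry (σ i) i).congr_deriv ?_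
  refine Finset.sum_congr rfl fun i _ => ?_
  rw [← Finset.prod_erase_mul _ _ (Finset.mem_univ i), smul_eq_mul]
  congr 1
  · exact Finset.prod_congr rfl fun j hj => by simp [updateCol_ne (Finset.ne_of_mem_erase hj)]
  · simp

theorem HasDerivAt.ringInverse_of_finiteDimensional {R : Type*} [NormedRing R] [NormedAlgebra ℝ R]
    [FiniteDimensional ℝ R] {f : ℝ → R} {f' : R} {t : ℝ} (hf : HasDerivAt f f' t)
    (hu : IsUnit (f t)) :
    HasDerivAt (fun s => Ring.inverse (f s)) (-(Ring.inverse (f t) * f' * Ring.inverse (f t))) t := by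
  have : CompleteSpace R := FiniteDimensional.complete ℝ R
  obtain ⟨u, hu⟩ := hu
  have h := hasFDerivAt_ringInverse (𝕜 := ℝ) u
  rw [hu] at h
  refine (h.comp_hasDerivAt t hf).congr_deriv ?_
  simp [← hu]

theorem HasDerivAt.matrix_inv {n : Type*} [Fintype n] [DecidableEq n] {S : ℝ → Matrix n n ℝ}
    {S' : Matrix n n ℝ} {t : ℝ} (hS : HasDerivAt S S' t) (hu : IsUnit (S t)) :
    HasDerivAt (fun s => (S s)⁻¹) (-((S t)⁻¹ * S' * (S t)⁻¹)) t := by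
  simp only [nonsing_inv_eq_ringInverse]
  exact @HasDerivAt.ringInverse_of_finiteDimensional (Matrix n n ℝ) Matrix.linftyOpNormedRing
    Matrix.linftyOpNormedAlgebra (inferInstanceAs (Module.Finite ℝ (Matrix n n ℝ))) S S' t hS hu

theorem HasDerivAt.matrix_dotProduct {n : Type*} [Fintype n] {v w : ℝ → n → ℝ}
    {v' w' : n → ℝ} {t : ℝ} (hv : HasDerivAt v v' t) (hw : HasDerivAt w w' t) :
    HasDerivAt (fun s => v s ⬝ᵥ w s) (v' ⬝ᵥ w t + v t ⬝ᵥ w') t := by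
  simp only [dotProduct, ← Finset.sum_add_distrib]
  exact HasDerivAt.fun_sum fun i _ => (hasDerivAt_pi.1 hv i).fun_mul (hasDerivAt_pi.1 hw i)

theorem HasDerivAt.matrix_mulVec {m n : Type*} [Fintype m] [Fintype n] {A : ℝ → Matrix m n ℝ}
    {A' : Matrix m n ℝ} {v : ℝ → n → ℝ} {v' : n → ℝ} {t : ℝ}
    (hA : HasDerivAt A A' t) (hv : HasDerivAt v v' t) :
    HasDerivAt (fun s => A s *ᵥ v s) (A' *ᵥ v t + A t *ᵥ v') t :=
  hasDerivAt_pi.2 fun i => (hasDerivAt_pi.1 hA i).matrix_dotProduct hv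

/-- The score function of the elliptical log-likelihood
`ℓ(t) = −(N/2) log det Σ(t) + Σ_j log p0(d_j(t)ᵀ Σ(t)⁻¹ d_j(t))` with respect to one
real parameter (Appendix A of the paper). -/
theorem stmt_4 {n : Type*} [Fintype n] [DecidableEq n] (N : ℕ) (hN : 1 ≤ N)
    (z : Fin N → n → ℝ) (p0 : ℝ → ℝ) (hp0 : Differentiable ℝ p0) (hp0pos : ∀ u, 0 < p0 u)
    (S : ℝ → Matrix n n ℝ) (μ : ℝ → n → ℝ) (t₀ : ℝ)
    (S' : Matrix n n ℝ) (μ' : n → ℝ)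
    (hS : HasDerivAt S S' t₀) (hμ : HasDerivAt μ μ' t₀)
    (hsym : (S t₀).IsSymm) (hpd : (S t₀).PosDef)
    (W : ℝ → ℝ) (hW : W = fun u => deriv p0 u / p0 u)
    (d : Fin N → n → ℝ) (hd : ∀ j, d j = z j - μ t₀)
    (q : Fin N → ℝ) (hq : ∀ j, q j = d j ⬝ᵥ (S t₀)⁻¹.mulVec (d j)) :
    HasDerivAt
      (fun t => -(N / 2 : ℝ) * Real.log (S t).det +
        ∑ j, Real.log (p0 ((z j - μ t) ⬝ᵥ (S t)⁻¹.mulVec (z j - μ t))))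
      (-(N / 2 : ℝ) * ((S t₀)⁻¹ * S').trace +
        ∑ j, W (q j) *
          (d j ⬝ᵥ (-((S t₀)⁻¹ * S' * (S t₀)⁻¹)).mulVec (d j)
            - 2 * (μ' ⬝ᵥ (S t₀)⁻¹.mulVec (d j)))) t₀ := by
  have hinv := hS.matrix_inv hpd.isUnit
  refine HasDerivAt.fun_add (HasDerivAt.const_mul _ ?_) (HasDerivAt.fun_sum fun j _ => ?_)
  · refine (hS.matrix_det.log hpd.det_pos.ne').congr_deriv ?_
    rw [inv_def, Ring.inverse_eq_inv', smul_mul_assoc, trace_smul, smul_eq_mul, div_eq_inv_mul]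
  · have hdj : HasDerivAt (fun t => z j - μ t) (-μ') t₀ := hμ.const_sub (z j)
    have hqj := hdj.matrix_dotProduct (hinv.matrix_mulVec hdj)
    refine (((hp0 _).hasDerivAt.comp t₀ hqj).log (hp0pos _).ne').congr_deriv ?_
    have hcross : d j ⬝ᵥ (S t₀)⁻¹ *ᵥ μ' = μ' ⬝ᵥ (S t₀)⁻¹ *ᵥ d j := by
      rw [dotProduct_mulVec, ← mulVec_transpose, transpose_nonsing_inv, hsym.eq, dotProduct_comm]
    simp only [hW, hq, ← hd, Function.comp_apply, dotProduct_add, mulVec_neg, dotProduct_neg,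
      neg_dotProduct, hcross]
    ring
end
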